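/- An entire function f of exponential type at most π satisfies ∫_ℝ |f(x)|² dx < ∞ if and only if ∫_ℝ |f(x)|² dμ(x) < ∞. Moreover, there exists a constant c > 0, independent of f, such that c·(∫_ℝ |f(x)|² dx)^{1/2} ≤ (∫_ℝ |f(x)|² dμ(x))^{1/2} ≤ (∫_ℝ |f(x)|² dx)^{1/2} for every entire function f of exponential type at most π with ∫_ℝ |f(x)|² dx < ∞. -/

import Mathlib

open Filter MeasureTheory Real Complex

/-- The pair correlation density `1 - (sin πx / (πx))²`. -/
noncomputable def pairCorKernel (x : ℝ) : ℝ := 1 - (Real.sin (π * x) / (π * x)) ^ 2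

/-- The pair correlation measure `dμ(x) = {1 - (sin πx/(πx))²} dx`. -/
noncomputable def pairCorMeasure : Measure ℝ :=
  volume.withDensity fun x => ENNReal.ofReal (pairCorKernel x)

/-- An entire function has exponential type at most `τ`. -/
def HasExpTypeLE (F : ℂ → ℂ) (τ : ℝ) : Prop :=
  ∀ ε > 0, ∃ C > 0, ∀ z : ℂ, ‖F z‖ ≤ C * Real.exp ((τ + ε) * ‖z‖)


lemma pc_half_plane {G : ℂ → ℂ} (hG : Differentiable ℂ G) {A a M : ℝ} (ha : 0 ≤ a)
    (hA : 0 ≤ A) (hexp : ∀ z, ‖G z‖ ≤ A * Real.exp (a * ‖z‖)) (s : ℂ) (hs : ‖s‖ = 1)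
    (hM : ∀ x : ℝ, ‖G (s * (x * I))‖ ≤ M) (w : ℂ) (hw : 0 ≤ w.re) :
    ‖G (s * w)‖ ≤ M * Real.exp (a * w.re) := by
  have key : ‖(fun w : ℂ => G (s * w) * Complex.exp (-a * w)) w‖ ≤ M := by
    have hb : ∀ w : ℂ, ‖G (s * w) * Complex.exp (-a * w)‖
        ≤ A * Real.exp (a * ‖w‖) * Real.exp (-(a * w.re)) := by
      intro w
      rw [norm_mul, Complex.norm_exp]
      have := hexp (s * w)
      rw [norm_mul, hs, one_mul] at this
      have e : (-(a : ℂ) * w).re = -(a * w.re) := by simp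
      rw [e]
      gcongr
    apply PhragmenLindelof.right_half_plane_of_bounded_on_real (C := M) (z := w)
    · apply Differentiable.diffContOnCl
      fun_prop
    · refine ⟨1, by norm_num, a, ?_⟩
      apply Asymptotics.IsBigO.of_bound A
      rw [Filter.eventually_inf_principal]
      refine Filter.Eventually.of_forall fun z hz => (hb z).trans ?_
      have hz' : 0 < z.re := hz
      rw [Real.rpow_one, Real.norm_of_nonneg (Real.exp_pos _).le]
      have : Real.exp (-(a * z.re)) ≤ 1 := Real.exp_le_one_iff.2 (by nlinarith)
      exact mul_le_of_le_one_right (by positivity) this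
    · refine ⟨A, ?_⟩
      rw [Filter.eventually_map]
      filter_upwards [Filter.eventually_ge_atTop 0] with x hx
      refine (hb x).trans ?_
      rw [Complex.norm_real, Real.norm_of_nonneg hx, Complex.ofReal_re, mul_assoc, ← Real.exp_add]
      simp
    · intro x
      have := hM x
      rw [norm_mul, Complex.norm_exp]
      simpa using this
    · exact hw
  have e : (-(a : ℂ) * w).re = -(a * w.re) := by simp
  simp only [norm_mul, Complex.norm_exp] at key
  rw [e, Real.exp_neg, ← div_eq_mul_inv, div_le_iff₀ (Real.exp_pos _)] at key
  exact key

lemma pc_strip {G : ℂ → ℂ} (hG : Differentiable ℂ G) {A a M : ℝ} (ha : 0 ≤ a)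
    (hA : 0 ≤ A) (hexp : ∀ z, ‖G z‖ ≤ A * Real.exp (a * ‖z‖))
    (hM : ∀ x : ℝ, ‖G x‖ ≤ M) (z : ℂ) :
    ‖G z‖ ≤ M * Real.exp (a * |z.im|) := by
  rcases le_total 0 z.im with h | h
  · have := pc_half_plane hG ha hA hexp I (by simp) (fun x => by
      have := hM (-x)
      have e : I * (x * I) = ((-x : ℝ) : ℂ) := by
        push_cast; linear_combination (x : ℂ) * Complex.I_mul_I
      rwa [e]) (-I * z) (by simpa using h)
    have e : I * (-I * z) = z := by linear_combination -z * Complex.I_mul_I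
    rw [e] at this
    simpa [abs_of_nonneg h] using this
  · have := pc_half_plane hG ha hA hexp (-I) (by simp) (fun x => by
      have := hM x
      have e : -I * (x * I) = (x : ℂ) := by
        linear_combination -(x : ℂ) * Complex.I_mul_I
      rwa [e]) (I * z) (by simpa using h)
    have e : -I * (I * z) = z := by linear_combination -z * Complex.I_mul_I
    rw [e] at this
    simpa [abs_of_nonpos h] using this

lemma pc_int_le {f : ℂ → ℂ} (hf : Differentiable ℂ f) {M : ℝ} (hM : 0 < M)
    (hint : Integrable (fun x : ℝ => ‖f x‖ ^ 2) volume)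
    (hle : ∫ x : ℝ, ‖f x‖ ^ 2 ≤ M ^ 2) (x h : ℝ) (h0 : 0 ≤ h) (h1 : h ≤ 1) :
    ∫ t in x..(x + h), ‖f t‖ ≤ M := by
  have hc : Continuous fun t : ℝ => f t := hf.continuous.comp Complex.continuous_ofReal
  have hxh : x ≤ x + h := by linarith
  have s1 : ∫ t in x..(x + h), ‖f t‖ ≤ ∫ t in x..(x + h), (‖f t‖ ^ 2 / M + M) / 2 := by
    apply intervalIntegral.integral_mono_on hxh
    · exact hc.norm.intervalIntegrable _ _
    · exact Continuous.intervalIntegrable ((((hc.norm.pow 2).div_const M).add continuous_const).div_const 2) _ _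
    · intro t _
      rw [le_div_iff₀ two_pos, div_add' _ _ _ hM.ne', le_div_iff₀ hM]
      nlinarith [sq_nonneg (‖f t‖ - M)]
  have s2 : ∫ t in x..(x + h), ‖f t‖ ^ 2 ≤ M ^ 2 := by
    refine le_trans ?_ hle
    rw [intervalIntegral.integral_of_le hxh]
    exact setIntegral_le_integral hint (Filter.Eventually.of_forall fun t => by positivity)
  have s3 : ∫ t in x..(x + h), (‖f t‖ ^ 2 / M + M) / 2
      = ((∫ t in x..(x + h), ‖f t‖ ^ 2) / M + h * M) / 2 := by
    rw [intervalIntegral.integral_div, intervalIntegral.integral_add, intervalIntegral.integral_div]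
    · simp
    · exact Continuous.intervalIntegrable ((hc.norm.pow 2).div_const M) _ _
    · simp
  rw [s3] at s1
  have s4 : (∫ t in x..(x + h), ‖f t‖ ^ 2) / M ≤ M := by
    rw [div_le_iff₀ hM]; nlinarith
  nlinarith

lemma pc_diff_le {f : ℂ → ℂ} (hf : Differentiable ℂ f) {C a M : ℝ} (ha : 0 ≤ a) (hC : 0 ≤ C)
    (hexp : ∀ z, ‖f z‖ ≤ C * Real.exp (a * ‖z‖)) (hM : 0 < M)
    (hint : Integrable (fun x : ℝ => ‖f x‖ ^ 2) volume)
    (hle : ∫ x : ℝ, ‖f x‖ ^ 2 ≤ M ^ 2) (x h : ℝ) (h0 : 0 ≤ h) (h1 : h ≤ 1) :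
    ‖f ((x + h : ℝ) : ℂ) - f x‖ ≤ Real.exp a * M := by
  obtain ⟨P, hP⟩ := hf.isExactOn_univ
  replace hP : ∀ z, HasDerivAt P (f z) z := fun z => by simpa using hP z (Set.mem_univ z)
  have hc : Continuous fun t : ℝ => f t := hf.continuous.comp Complex.continuous_ofReal
  set G : ℂ → ℂ := fun z => P (z + h) - P z with hGdef
  have hG' : ∀ z, HasDerivAt G (f (z + h) - f z) z := fun z =>
    ((hP (z + h)).comp_add_const z (h : ℂ)).sub (hP z)
  have hGd : Differentiable ℂ G := fun z => (hG' z).differentiableAt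
  have hGexp : ∀ z, ‖G z‖ ≤ (C * Real.exp a) * Real.exp (a * ‖z‖) := by
    intro z
    have := (convex_closedBall z 1).norm_image_sub_le_of_norm_hasDerivWithin_le (f := P) (f' := f)
      (C := (C * Real.exp a) * Real.exp (a * ‖z‖)) (x := z) (y := z + h)
      (fun w _ => (hP w).hasDerivWithinAt) (fun w hw => by
        refine (hexp w).trans ?_
        rw [mul_assoc, ← Real.exp_add]
        have : ‖w‖ ≤ ‖z‖ + 1 := by
          have h2 : ‖w - z‖ ≤ 1 := by simpa [dist_eq_norm] using hw
          have := norm_le_insert' w z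
          linarith
        gcongr
        nlinarith) (by simp) (by simpa [abs_of_nonneg h0] using h1)
    refine this.trans ?_
    refine mul_le_of_le_one_right (by positivity) ?_
    simpa [abs_of_nonneg h0] using h1
  have hGr : ∀ y : ℝ, ‖G y‖ ≤ M := by
    intro y
    have e : ∫ t in y..(y + h), f t = P ((y + h : ℝ) : ℂ) - P y :=
      intervalIntegral.integral_eq_sub_of_hasDerivAt (f := fun t : ℝ => P t)
        (fun t _ => (hP t).comp_ofReal) (hc.intervalIntegrable _ _)
    have e2 : G y = ∫ t in y..(y + h), f t := by rw [e]; simp [hGdef]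
    rw [e2]
    exact (intervalIntegral.norm_integral_le_integral_norm (by linarith)).trans
      (pc_int_le hf hM hint hle y h h0 h1)
  have hstrip := pc_strip hGd ha (by positivity) hGexp hGr
  have := Complex.norm_deriv_le_of_forall_mem_sphere_norm_le (c := (x : ℂ)) (R := 1)
    (C := Real.exp a * M) (f := G) one_pos hGd.diffContOnCl (fun z hz => by
      refine (hstrip z).trans ?_
      rw [mul_comm]
      have h2 : ‖z - x‖ = 1 := by simpa [dist_eq_norm] using hz
      have h3 : |z.im| ≤ 1 := by
        have := Complex.abs_im_le_norm (z - x)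
        simpa [h2] using this
      gcongr
      nlinarith)
  rw [(hG' x).deriv] at this
  simpa using this

lemma pc_ptwise {f : ℂ → ℂ} (hf : Differentiable ℂ f) {C a M : ℝ} (ha : 0 ≤ a) (hC : 0 ≤ C)
    (hexp : ∀ z, ‖f z‖ ≤ C * Real.exp (a * ‖z‖)) (hM : 0 < M)
    (hint : Integrable (fun x : ℝ => ‖f x‖ ^ 2) volume)
    (hle : ∫ x : ℝ, ‖f x‖ ^ 2 ≤ M ^ 2) (x : ℝ) :
    ‖f x‖ ≤ (1 + Real.exp a) * M := by
  have hc : Continuous fun t : ℝ => f t := hf.continuous.comp Complex.continuous_ofReal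
  have h1 : ∫ t in x..(x + 1), ‖f x‖ ≤ ∫ t in x..(x + 1), (‖f t‖ + Real.exp a * M) := by
    apply intervalIntegral.integral_mono_on (by linarith)
    · simp
    · exact Continuous.intervalIntegrable (hc.norm.add continuous_const) _ _
    · intro t ht
      have := pc_diff_le hf ha hC hexp hM hint hle x (t - x) (by linarith [ht.1])
        (by linarith [ht.2])
      rw [add_sub_cancel] at this
      have h2 := norm_sub_norm_le (f x) (f t)
      rw [norm_sub_rev] at h2
      linarith
  rw [intervalIntegral.integral_add (hc.norm.intervalIntegrable _ _) (by simp)] at h1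
  have := pc_int_le hf hM hint hle x 1 zero_le_one le_rfl
  simp at h1
  linarith

lemma pc_kernel_nonneg (x : ℝ) : 0 ≤ pairCorKernel x := by
  unfold pairCorKernel
  have h : |Real.sin (π * x) / (π * x)| ≤ 1 := by
    rw [abs_div]
    exact div_le_one_of_le₀ Real.abs_sin_le_abs (abs_nonneg _)
  have := (sq_le_one_iff_abs_le_one _).2 h
  linarith

lemma pc_kernel_le_one (x : ℝ) : pairCorKernel x ≤ 1 := by
  unfold pairCorKernel
  nlinarith [sq_nonneg (Real.sin (π * x) / (π * x))]

lemma pc_kernel_measurable : Measurable pairCorKernel := by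
  unfold pairCorKernel
  fun_prop

lemma pc_kernel_neg (x : ℝ) : pairCorKernel (-x) = pairCorKernel x := by
  simp [pairCorKernel, neg_div_neg_eq]

lemma pc_kernel_pos (x : ℝ) (hx : x ≠ 0) : 0 < pairCorKernel x := by
  unfold pairCorKernel
  have hy : π * x ≠ 0 := mul_ne_zero Real.pi_ne_zero hx
  have h : |Real.sin (π * x) / (π * x)| < 1 := by
    rw [abs_div]
    exact (div_lt_one (abs_pos.2 hy)).2 (Real.abs_sin_lt_abs hy)
  have := (sq_lt_one_iff_abs_lt_one _).2 h
  linarith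

lemma pc_kernel_lower {δ : ℝ} (hδ : 0 < δ) (hδ1 : δ ≤ 1) :
    ∃ κ > 0, ∀ x : ℝ, δ ≤ |x| → κ ≤ pairCorKernel x := by
  have hcont : ContinuousOn pairCorKernel (Set.Icc δ 1) := by
    unfold pairCorKernel
    refine continuousOn_const.sub (ContinuousOn.pow (ContinuousOn.div (by fun_prop) (by fun_prop) ?_) 2)
    intro x hx
    exact mul_ne_zero Real.pi_ne_zero (by linarith [hx.1])
  obtain ⟨x0, hx0, hmin⟩ := isCompact_Icc.exists_isMinOn ⟨δ, le_rfl, hδ1⟩ hcont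
  refine ⟨min (pairCorKernel x0) (1 / 2),
    lt_min (pc_kernel_pos _ (by linarith [hx0.1])) (by norm_num), ?_⟩
  have habs : ∀ x, pairCorKernel |x| = pairCorKernel x := by
    intro x
    rcases abs_choice x with h | h <;> rw [h]
    exact pc_kernel_neg x
  intro x hx
  rcases le_total |x| 1 with h | h
  · exact (min_le_left _ _).trans ((hmin ⟨hx, h⟩).trans_eq (habs x))
  · refine (min_le_right _ _).trans ?_
    unfold pairCorKernel
    have hpi := Real.pi_gt_three
    have h2 : |Real.sin (π * x) / (π * x)| ≤ 1 / 2 := by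
      rw [abs_div, abs_mul, abs_of_pos Real.pi_pos]
      rw [div_le_div_iff₀ (by positivity) two_pos]
      have := Real.abs_sin_le_one (π * x)
      nlinarith
    have := sq_le_sq' (abs_le.1 h2).1 (abs_le.1 h2).2
    linarith

lemma pc_integrable_iff (g : ℝ → ℝ) :
    Integrable g pairCorMeasure ↔ Integrable (fun x => g x * pairCorKernel x) volume := by
  unfold pairCorMeasure
  rw [integrable_withDensity_iff pc_kernel_measurable.ennreal_ofReal (by simp)]
  simp only [ENNReal.toReal_ofReal (pc_kernel_nonneg _)]

lemma pc_integral_eq (g : ℝ → ℝ) :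
    ∫ x, g x ∂pairCorMeasure = ∫ x, g x * pairCorKernel x := by
  unfold pairCorMeasure
  rw [integral_withDensity_eq_integral_toReal_smul pc_kernel_measurable.ennreal_ofReal (by simp)]
  simp only [ENNReal.toReal_ofReal (pc_kernel_nonneg _), smul_eq_mul, mul_comm]

lemma pc_integrable_mul {g : ℝ → ℝ} (hg : Integrable g volume) :
    Integrable (fun x => g x * pairCorKernel x) volume := by
  refine hg.mul_bdd (c := 1) pc_kernel_measurable.aestronglyMeasurable
    (Filter.Eventually.of_forall fun x => ?_)
  rw [Real.norm_of_nonneg (pc_kernel_nonneg x)]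
  exact pc_kernel_le_one x

theorem norm_equivalence_pair_correlation_measure :
    (∀ f : ℂ → ℂ, Differentiable ℂ f → HasExpTypeLE f π →
      (Integrable (fun x : ℝ => ‖f x‖ ^ 2) volume ↔
        Integrable (fun x : ℝ => ‖f x‖ ^ 2) pairCorMeasure)) ∧
    ∃ c > 0, ∀ f : ℂ → ℂ, Differentiable ℂ f → HasExpTypeLE f π →
      Integrable (fun x : ℝ => ‖f x‖ ^ 2) volume →
      c * Real.sqrt (∫ x : ℝ, ‖f x‖ ^ 2) ≤ Real.sqrt (∫ x : ℝ, ‖f x‖ ^ 2 ∂pairCorMeasure) ∧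
      Real.sqrt (∫ x : ℝ, ‖f x‖ ^ 2 ∂pairCorMeasure) ≤ Real.sqrt (∫ x : ℝ, ‖f x‖ ^ 2) := by
  constructor
  · intro f hf _
    have hc : Continuous fun t : ℝ => ‖f t‖ ^ 2 :=
      (hf.continuous.comp Complex.continuous_ofReal).norm.pow 2
    rw [pc_integrable_iff]
    refine ⟨pc_integrable_mul, fun h => ?_⟩
    obtain ⟨κ, hκ, hk⟩ := pc_kernel_lower one_pos le_rfl
    rw [← integrableOn_univ, ← Set.union_compl_self (Set.Icc (-1 : ℝ) 1)]
    refine (hc.continuousOn.integrableOn_compact isCompact_Icc).union ?_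
    refine Integrable.mono' ((h.const_mul κ⁻¹).integrableOn) hc.aestronglyMeasurable ?_
    refine (ae_restrict_iff' measurableSet_Icc.compl).2 (Filter.Eventually.of_forall fun x hx => ?_)
    have hx1 : 1 ≤ |x| := by
      by_contra hlt
      push Not at hlt
      exact hx ⟨(abs_lt.1 hlt).1.le, (abs_lt.1 hlt).2.le⟩
    have := hk x hx1
    rw [Real.norm_of_nonneg (by positivity), inv_mul_eq_div, le_div_iff₀ hκ]
    gcongr
  · set K : ℝ := (1 + Real.exp (π + 1)) ^ 2 with hK
    have hK1 : 1 ≤ K := by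
      have := Real.exp_pos (π + 1)
      nlinarith
    set δ : ℝ := 1 / (4 * K) with hδ
    have hδ0 : 0 < δ := by positivity
    have hδK : 2 * δ * K = 1 / 2 := by rw [hδ]; field_simp; norm_num
    have hδ1 : δ ≤ 1 := by nlinarith
    obtain ⟨κ, hκ, hk⟩ := pc_kernel_lower hδ0 hδ1
    refine ⟨Real.sqrt (κ / 2), Real.sqrt_pos.2 (by positivity), fun f hf hexp hint => ?_⟩
    have hint2 := pc_integrable_mul hint
    have hc : Continuous fun t : ℝ => ‖f t‖ ^ 2 :=
      (hf.continuous.comp Complex.continuous_ofReal).norm.pow 2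
    rw [pc_integral_eq]
    constructor
    · rw [← Real.sqrt_mul (by positivity)]
      apply Real.sqrt_le_sqrt
      set N := ∫ x : ℝ, ‖f x‖ ^ 2 with hN
      have hN0 : 0 ≤ N := integral_nonneg fun x => by positivity
      rcases hN0.eq_or_lt with h0 | hpos
      · rw [← h0, mul_zero]
        exact integral_nonneg fun x => mul_nonneg (by positivity) (pc_kernel_nonneg x)
      obtain ⟨C, hC, hCf⟩ := hexp 1 one_pos
      have hpt : ∀ x : ℝ, ‖f x‖ ^ 2 ≤ K * N := by
        intro x
        have := pc_ptwise hf (by positivity) hC.le hCf (Real.sqrt_pos.2 hpos) hint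
          (Real.sq_sqrt hN0).ge x
        calc ‖f x‖ ^ 2 ≤ ((1 + Real.exp (π + 1)) * Real.sqrt N) ^ 2 := by gcongr
          _ = K * N := by rw [mul_pow, Real.sq_sqrt hN0]
      have hin : ∫ x in Set.Icc (-δ) δ, ‖f x‖ ^ 2 ≤ N / 2 := by
        have : ∫ x in Set.Icc (-δ) δ, ‖f x‖ ^ 2 ≤ ∫ x in Set.Icc (-δ) δ, K * N :=
          setIntegral_mono_on hint.integrableOn (integrableOn_const (by simp)) measurableSet_Icc fun x _ => hpt x
        refine this.trans_eq ?_
        rw [setIntegral_const, smul_eq_mul, measureReal_def, Real.volume_Icc,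
          ENNReal.toReal_ofReal (by linarith)]
        linear_combination N * hδK
      have hsplit := integral_add_compl (measurableSet_Icc (a := -δ) (b := δ)) hint
      have hout : κ * ∫ x in (Set.Icc (-δ) δ)ᶜ, ‖f x‖ ^ 2
          ≤ ∫ x in (Set.Icc (-δ) δ)ᶜ, ‖f x‖ ^ 2 * pairCorKernel x := by
        rw [← integral_const_mul]
        refine setIntegral_mono_on (hint.const_mul κ).integrableOn hint2.integrableOn
          measurableSet_Icc.compl fun x hx => ?_
        have hx1 : δ ≤ |x| := by
          by_contra hlt
          push Not at hlt
          exact hx ⟨(abs_lt.1 hlt).1.le, (abs_lt.1 hlt).2.le⟩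
        rw [mul_comm]
        have := hk x hx1
        gcongr
      have hle : ∫ x in (Set.Icc (-δ) δ)ᶜ, ‖f x‖ ^ 2 * pairCorKernel x
          ≤ ∫ x : ℝ, ‖f x‖ ^ 2 * pairCorKernel x :=
        setIntegral_le_integral hint2 (Filter.Eventually.of_forall fun x =>
          mul_nonneg (by positivity) (pc_kernel_nonneg x))
      refine le_trans ?_ (hout.trans hle)
      have : N / 2 ≤ ∫ x in (Set.Icc (-δ) δ)ᶜ, ‖f x‖ ^ 2 := by linarith
      nlinarith
    · apply Real.sqrt_le_sqrt
      apply integral_mono hint2 hint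
      intro x
      exact mul_le_of_le_one_right (by positivity) (pc_kernel_le_one x)
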